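/- arXiv:1803.09738 — 2 statements merged into one kernel-verified Lean document; each statement's English description precedes it below -/
import Mathlib

section
/- For every integer n ≥ 1, with m determined by n as indicated, the following identity holds in ℚ(q): ∑_{r=0}^{n} (-1)^r q^{r(r-1)/2} (-q;q)_{n-r} [2n-r+1 choose r]_q · (1-q^{2n+1})/(1-q^{2n-r+1}) equals (-1)^m q^{m(3m-1)} if n = 2m-1 is odd, and equals (-1)^m q^{m(3m+1)} if n = 2m is even. -/
open Finset

/-- The indeterminate `q`, as an element of the field `ℚ(q)` of rational functions. -/
noncomputable def q : RatFunc ℚ := RatFunc.X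

/-- The q-Pochhammer symbol `(a; q)_n` for a nonnegative integer `n`. -/
noncomputable def qPoch (a : RatFunc ℚ) (n : ℕ) : RatFunc ℚ :=
  ∏ k ∈ Finset.range n, (1 - a * q ^ k)

/-- The q-Pochhammer symbol `(a; q)_n` for an arbitrary integer `n`, where for `n > 0`
`(a; q)_{-n} = 1 / (a q^{-n}; q)_n`. -/
noncomputable def qPochZ (a : RatFunc ℚ) (n : ℤ) : RatFunc ℚ :=
  if 0 ≤ n then qPoch a n.toNat else 1 / qPoch (a * q ^ n) (-n).toNat

/-- The Gaussian (q-)binomial coefficient `[n choose m]_q`, equal to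
`(q;q)_n / ((q;q)_m (q;q)_{n-m})` for `0 ≤ m ≤ n` and `0` otherwise. -/
noncomputable def qbinom (n m : ℤ) : RatFunc ℚ :=
  if 0 ≤ m ∧ m ≤ n then
    qPoch q n.toNat / (qPoch q m.toNat * qPoch q (n - m).toNat)
  else 0

theorem q_ne_zero : q ≠ 0 := RatFunc.X_ne_zero

theorem one_sub_q_pow_ne_zero (n : ℕ) : 1 - q ^ (n + 1) ≠ 0 := by
  have h : (1 - Polynomial.X ^ (n + 1) : Polynomial ℚ) ≠ 0 := by
    intro h
    have := congrArg (Polynomial.eval 0) h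
    simp at this
  have h' := (map_ne_zero_iff _ (RatFunc.algebraMap_injective ℚ)).mpr h
  simpa [q] using h'

theorem qPoch_succ (n : ℕ) : qPoch q (n + 1) = qPoch q n * (1 - q ^ (n + 1)) := by
  rw [qPoch, Finset.prod_range_succ, ← qPoch, pow_succ']

theorem qPoch_ne_zero (n : ℕ) : qPoch q n ≠ 0 := by
  rw [qPoch, Finset.prod_ne_zero_iff]
  intro k _
  rw [← pow_succ']
  exact one_sub_q_pow_ne_zero k

theorem qbinom_add (a b : ℕ) :
    qbinom ((a : ℤ) + b) a = qPoch q (a + b) / (qPoch q a * qPoch q b) := by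
  have h : ((a : ℤ) + b).toNat = a + b := by omega
  simp [qbinom, h]

theorem qbinom_eq_zero {n m : ℤ} (h : m < 0 ∨ n < m) : qbinom n m = 0 :=
  if_neg (by omega)

theorem qbinom_symm (n m : ℤ) : qbinom n (n - m) = qbinom n m := by
  unfold qbinom
  by_cases h : 0 ≤ m ∧ m ≤ n
  · rw [if_pos h, if_pos (by omega), sub_sub_cancel, mul_comm]
  · rw [if_neg h, if_neg (by omega)]

theorem qbinom_zero_right (n : ℕ) : qbinom n 0 = 1 := by
  simp [qbinom, qPoch_ne_zero, show qPoch q 0 = 1 from rfl]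

theorem qbinom_self (n : ℕ) : qbinom n n = 1 := by
  rw [← qbinom_symm, sub_self, qbinom_zero_right]

theorem qbinom_pascal (n : ℕ) (k : ℤ) :
    qbinom ((n : ℤ) + 1) k = qbinom n (k - 1) + q ^ k * qbinom n k := by
  rcases lt_trichotomy k 0 with hk | rfl | hk
  · rw [qbinom_eq_zero (by omega), qbinom_eq_zero (by omega), qbinom_eq_zero (by omega)]
    simp
  · rw [qbinom_eq_zero (m := 0 - 1) (by omega), qbinom_zero_right n]
    exact_mod_cast (by simpa using qbinom_zero_right (n + 1))
  · rcases lt_trichotomy k (n + 1) with hn | rfl | hn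
    · obtain ⟨a, rfl⟩ : ∃ a : ℕ, k = a + 1 := ⟨(k - 1).toNat, by omega⟩
      obtain ⟨b, rfl⟩ : ∃ b : ℕ, n = a + b + 1 := ⟨n - a - 1, by omega⟩
      have h1 := qbinom_add (a + 1) (b + 1)
      have h2 := qbinom_add a (b + 1)
      have h3 := qbinom_add (a + 1) b
      rw [show ((a + b + 1 : ℕ) : ℤ) + 1 = ((a + 1 : ℕ) : ℤ) + (b + 1 : ℕ) by push_cast; ring,
        show (a : ℤ) + 1 = (a + 1 : ℕ) by push_cast; ring, h1,
        show ((a + b + 1 : ℕ) : ℤ) = ((a + 1 : ℕ) : ℤ) + b by push_cast; ring, h3,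
        show ((a + 1 : ℕ) : ℤ) + b = (a : ℤ) + (b + 1 : ℕ) by push_cast; ring,
        show ((a + 1 : ℕ) : ℤ) - 1 = a by push_cast; ring, h2, zpow_natCast,
        show a + 1 + (b + 1) = a + b + 1 + 1 by ring, show a + (b + 1) = a + b + 1 by ring,
        show a + 1 + b = a + b + 1 by ring, qPoch_succ (a + b + 1), qPoch_succ a, qPoch_succ b]
      have := qPoch_ne_zero a
      have := qPoch_ne_zero b
      have := one_sub_q_pow_ne_zero a
      have := one_sub_q_pow_ne_zero b
      field_simp
      ring
    · rw [qbinom_eq_zero (n := n) (m := (n : ℤ) + 1) (by omega), add_sub_cancel_right,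
        qbinom_self n]
      exact_mod_cast (by simpa using qbinom_self (n + 1))
    · rw [qbinom_eq_zero (by omega), qbinom_eq_zero (by omega), qbinom_eq_zero (by omega)]
      simp

theorem qbinom_pascal' (n : ℕ) (k : ℤ) :
    qbinom ((n : ℤ) + 1) k = qbinom n k + q ^ ((n : ℤ) + 1 - k) * qbinom n (k - 1) := by
  rw [← qbinom_symm, qbinom_pascal, ← qbinom_symm n k, ← qbinom_symm n (k - 1)]
  ring_nf

/-- The terms of the bilateral sum `∑ (-1)^m q^(3m²+am) [N, c-2m]`. -/
noncomputable def bilateralTerm (a N c m : ℤ) : RatFunc ℚ :=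
  (-1) ^ m * q ^ (3 * m ^ 2 + a * m) * qbinom N (c - 2 * m)

theorem finite_support_mul_qbinom (f : ℤ → RatFunc ℚ) (N c : ℤ) :
    (Function.support fun m : ℤ => f m * qbinom N (c - 2 * m)).Finite := by
  refine (Set.finite_Icc (-|N| - |c|) (|N| + |c|)).subset fun m hm => ?_
  by_contra h
  refine hm ?_
  have : qbinom N (c - 2 * m) = 0 := qbinom_eq_zero (by simp only [Set.mem_Icc] at h; grind)
  simp [this]

theorem finsum_bilateralTerm_eq_zero (n : ℕ) :
    ∑ᶠ m : ℤ, bilateralTerm 3 (2 * n) ((n : ℤ) - 1) m = 0 := by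
  have h : ∑ᶠ m : ℤ, bilateralTerm 3 (2 * n) ((n : ℤ) - 1) m =
      - ∑ᶠ m : ℤ, bilateralTerm 3 (2 * n) ((n : ℤ) - 1) m := by
    rw [← finsum_neg_distrib, ← finsum_comp_equiv (Equiv.subLeft (-1 : ℤ))]
    refine finsum_congr fun m => ?_
    simp only [bilateralTerm, Equiv.subLeft_apply]
    rw [← qbinom_symm, zpow_sub₀ (by norm_num)]
    have : ((-1 : RatFunc ℚ) ^ m)⁻¹ = (-1) ^ m := by rw [← inv_zpow]; norm_num
    rw [div_eq_mul_inv, this]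
    ring_nf
  exact self_eq_neg.mp h

theorem finsum_bilateralTerm_even (n : ℕ) :
    ∑ᶠ m : ℤ, bilateralTerm 1 (2 * (n : ℤ) + 1) n m = ∑ᶠ m : ℤ, bilateralTerm 1 (2 * n) n m := by
  have h : ∀ m : ℤ, bilateralTerm 1 (2 * (n : ℤ) + 1) n m =
      bilateralTerm 1 (2 * n) n m +
        q ^ (n + 1) * bilateralTerm 3 (2 * n) ((n : ℤ) - 1) m := by
    intro m
    have h := qbinom_pascal' (2 * n) ((n : ℤ) - 2 * m)
    push_cast at h
    simp only [bilateralTerm]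
    rw [h, show (n : ℤ) - 2 * m - 1 = n - 1 - 2 * m by ring,
      show 2 * (n : ℤ) + 1 - (n - 2 * m) = ((n + 1 : ℕ) : ℤ) + 2 * m by push_cast; ring,
      show 3 * m ^ 2 + 3 * m = (3 * m ^ 2 + 1 * m) + 2 * m by ring,
      zpow_add₀ q_ne_zero ((n + 1 : ℕ) : ℤ), zpow_add₀ q_ne_zero (3 * m ^ 2 + 1 * m),
      zpow_natCast]
    ring
  have hf (a c : ℤ) : (Function.support (bilateralTerm a (2 * n) c)).Finite :=
    finite_support_mul_qbinom _ _ _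
  rw [finsum_congr h, finsum_add_distrib (hf _ _), ← mul_finsum,
    finsum_bilateralTerm_eq_zero, mul_zero, add_zero]
  exact (hf _ _).subset fun m hm => right_ne_zero_of_mul hm

theorem finsum_bilateralTerm_odd (n : ℕ) :
    ∑ᶠ m : ℤ, bilateralTerm 1 (2 * ((n + 1 : ℕ) : ℤ)) (n + 1 : ℕ) m =
      (1 + q ^ (n + 1)) * ∑ᶠ m : ℤ, bilateralTerm 1 (2 * (n : ℤ) + 1) n m := by
  have h : ∀ m : ℤ, bilateralTerm 1 (2 * ((n + 1 : ℕ) : ℤ)) (n + 1 : ℕ) m =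
      bilateralTerm 1 (2 * (n : ℤ) + 1) n m +
        q ^ (n + 1) * bilateralTerm 1 (2 * (n : ℤ) + 1) n (-m) := by
    intro m
    have h := qbinom_pascal (2 * n + 1) (((n + 1 : ℕ) : ℤ) - 2 * m)
    have hs := qbinom_symm (2 * (n : ℤ) + 1) (n - 2 * -m)
    rw [show 2 * (n : ℤ) + 1 - (n - 2 * -m) = ((n + 1 : ℕ) : ℤ) - 2 * m by push_cast; ring] at hs
    simp only [bilateralTerm]
    rw [show 2 * ((n + 1 : ℕ) : ℤ) = ((2 * n + 1 : ℕ) : ℤ) + 1 by push_cast; ring, h, ← hs,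
      show ((n + 1 : ℕ) : ℤ) - 2 * m - 1 = n - 2 * m by push_cast; ring,
      show ((2 * n + 1 : ℕ) : ℤ) = 2 * (n : ℤ) + 1 by push_cast; ring,
      show 3 * (-m) ^ 2 + 1 * -m = (3 * m ^ 2 + 1 * m) - 2 * m by ring,
      zpow_sub₀ q_ne_zero, zpow_sub₀ q_ne_zero (3 * m ^ 2 + 1 * m), zpow_natCast, zpow_neg]
    have : ((-1 : RatFunc ℚ) ^ m)⁻¹ = (-1) ^ m := by rw [← inv_zpow]; norm_num
    rw [this]
    ring
  have hf : (Function.support (bilateralTerm 1 (2 * (n : ℤ) + 1) n)).Finite :=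
    finite_support_mul_qbinom _ _ _
  have hn : ∑ᶠ m : ℤ, bilateralTerm 1 (2 * (n : ℤ) + 1) n (-m) =
      ∑ᶠ m : ℤ, bilateralTerm 1 (2 * (n : ℤ) + 1) n m :=
    finsum_comp_equiv (Equiv.neg ℤ)
  rw [finsum_congr h, finsum_add_distrib hf, ← mul_finsum, hn]
  · ring
  · refine (hf.preimage (f := fun m : ℤ => -m) neg_injective.injOn).subset fun m hm => ?_
    exact right_ne_zero_of_mul hm

theorem qPoch_neg_q_eq_finsum (n : ℕ) :
    qPoch (-q) n = ∑ᶠ m : ℤ, bilateralTerm 1 (2 * (n : ℤ) + 1) n m := by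
  induction n with
  | zero =>
    rw [finsum_eq_single _ 0]
    · simpa [bilateralTerm, qPoch] using (qbinom_zero_right 1).symm
    · intro m hm
      rw [bilateralTerm, qbinom_eq_zero (by push_cast; omega), mul_zero]
  | succ n ih =>
    rw [finsum_bilateralTerm_even, finsum_bilateralTerm_odd, ← ih, qPoch, Finset.prod_range_succ,
      ← qPoch]
    ring

/-- The summand of the orthogonality relation between the two inverse matrices, without the factor
`1 - q^(2n+1)`, where `n = k + d`. -/
noncomputable def orthTerm (k d i : ℕ) : RatFunc ℚ :=
  (-1) ^ (d - i) * q ^ ((d - i).choose 2) * qPoch q (2 * k + d + i) /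
    (qPoch q (d - i) * qPoch q i * qPoch q (2 * k + i + 1))

theorem orthTerm_succ (k i e : ℕ) :
    orthTerm k (i + 1 + e) (i + 1) * (q ^ e * (1 - q ^ (i + 1)) * (1 - q ^ (2 * k + i + 2))) =
      -orthTerm k (i + 1 + e) i *
        ((1 - q ^ (e + 1)) * (1 - q ^ (2 * k + 2 * i + e + 2))) := by
  have h1 : i + 1 + e - i = e + 1 := by omega
  have h2 : i + 1 + e - (i + 1) = e := by omega
  have h3 : (e + 1).choose 2 = e + e.choose 2 := by
    rw [Nat.choose_succ_succ' e 1, Nat.choose_one_right]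
  rw [orthTerm, orthTerm, h1, h2, h3,
    show 2 * k + (i + 1 + e) + (i + 1) = (2 * k + 2 * i + e + 1) + 1 by ring,
    show 2 * k + (i + 1 + e) + i = 2 * k + 2 * i + e + 1 by ring,
    show 2 * k + (i + 1) + 1 = (2 * k + i + 1) + 1 by ring,
    qPoch_succ (2 * k + 2 * i + e + 1), qPoch_succ e, qPoch_succ i, qPoch_succ (2 * k + i + 1)]
  have := qPoch_ne_zero e
  have := qPoch_ne_zero i
  have := qPoch_ne_zero (2 * k + i + 1)
  have := one_sub_q_pow_ne_zero e
  have := one_sub_q_pow_ne_zero i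
  have := one_sub_q_pow_ne_zero (2 * k + i + 1)
  field_simp
  ring

theorem sum_range_orthTerm (k i e : ℕ) :
    (∑ j ∈ range i, orthTerm k (i + e) j) * ((1 - q ^ (i + e)) * (1 - q ^ (2 * k + i + e + 1))) =
      -(q ^ e * (1 - q ^ i) * (1 - q ^ (2 * k + i + 1))) * orthTerm k (i + e) i := by
  induction i generalizing e with
  | zero => simp
  | succ i ih =>
    have h := ih (e + 1)
    have hs := orthTerm_succ k i e
    rw [show i + (e + 1) = i + 1 + e by ring] at h
    rw [sum_range_succ]
    linear_combination h + hs

theorem sum_orthTerm_eq_zero (k d : ℕ) : ∑ i ∈ range (d + 2), orthTerm k (d + 1) i = 0 := by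
  have h := sum_range_orthTerm k (d + 1) 0
  have h1 := one_sub_q_pow_ne_zero d
  have h2 := one_sub_q_pow_ne_zero (2 * k + d + 1)
  rw [sum_range_succ]
  refine (mul_eq_zero.mp ?_).resolve_right (mul_ne_zero h1 h2)
  simp only [add_zero] at h
  linear_combination h

/-- The entries of the inverse of the matrix `[2j+1, j-k]`. -/
noncomputable def inverseCoeff (n j : ℕ) : RatFunc ℚ :=
  (-1) ^ (n - j) * q ^ ((n - j).choose 2) * qbinom ((n : ℤ) + j + 1) ((n : ℤ) - j) *
    ((1 - q ^ (2 * n + 1)) / (1 - q ^ (n + j + 1)))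

theorem inverseCoeff_mul_qbinom (k e i : ℕ) :
    inverseCoeff (k + (i + e)) (k + i) *
        qbinom (2 * ((k + i : ℕ) : ℤ) + 1) (((k + i : ℕ) : ℤ) - k) =
      (1 - q ^ (2 * (k + (i + e)) + 1)) * orthTerm k (i + e) i := by
  have h1 := qbinom_add e (2 * k + 2 * i + 1)
  have h2 := qbinom_add i (2 * k + i + 1)
  rw [inverseCoeff, orthTerm,
    show ((k + (i + e) : ℕ) : ℤ) + (k + i : ℕ) + 1 = e + (2 * k + 2 * i + 1 : ℕ) by
      push_cast; ring,
    show ((k + (i + e) : ℕ) : ℤ) - (k + i : ℕ) = e by push_cast; ring,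
    show 2 * ((k + i : ℕ) : ℤ) + 1 = i + (2 * k + i + 1 : ℕ) by push_cast; ring,
    show ((k + i : ℕ) : ℤ) - k = i by push_cast; ring, h1, h2,
    show k + (i + e) - (k + i) = e by omega, show i + e - i = e by omega,
    show e + (2 * k + 2 * i + 1) = (2 * k + 2 * i + e) + 1 by ring,
    show k + (i + e) + (k + i) + 1 = (2 * k + 2 * i + e) + 1 by ring,
    show i + (2 * k + i + 1) = 2 * k + 2 * i + 1 by ring,
    show 2 * k + (i + e) + i = 2 * k + 2 * i + e by ring, qPoch_succ (2 * k + 2 * i + e)]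
  have := qPoch_ne_zero e
  have := qPoch_ne_zero i
  have := qPoch_ne_zero (2 * k + i + 1)
  have := qPoch_ne_zero (2 * k + 2 * i + 1)
  have := one_sub_q_pow_ne_zero (2 * k + 2 * i + e)
  field_simp

theorem sum_inverseCoeff_mul_qbinom_natCast (n k : ℕ) :
    ∑ j ∈ range (n + 1), inverseCoeff n j * qbinom (2 * (j : ℤ) + 1) ((j : ℤ) - k) =
      if n = k then 1 else 0 := by
  rcases lt_or_ge n k with h | h
  · rw [if_neg h.ne]
    refine sum_eq_zero fun j hj => ?_
    rw [mem_range] at hj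
    rw [qbinom_eq_zero (by omega), mul_zero]
  obtain ⟨d, rfl⟩ := Nat.exists_eq_add_of_le h
  have hsum : ∑ j ∈ range (k + d + 1),
      inverseCoeff (k + d) j * qbinom (2 * (j : ℤ) + 1) ((j : ℤ) - k) =
      (1 - q ^ (2 * (k + d) + 1)) * ∑ i ∈ range (d + 1), orthTerm k d i := by
    rw [add_assoc, sum_range_add, sum_eq_zero, zero_add, mul_sum]
    · refine sum_congr rfl fun i hi => ?_
      obtain ⟨e, rfl⟩ := Nat.exists_eq_add_of_le (Nat.le_of_lt_succ (mem_range.mp hi))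
      exact inverseCoeff_mul_qbinom k e i
    · intro j hj
      rw [mem_range] at hj
      rw [qbinom_eq_zero (by omega), mul_zero]
  rw [hsum]
  cases d with
  | zero =>
    have h1 := qPoch_ne_zero (2 * k)
    have h2 := one_sub_q_pow_ne_zero (2 * k)
    simp only [add_zero, zero_add, sum_range_one, orthTerm, if_true, qPoch_succ]
    simp only [qPoch, range_zero, prod_empty] at h1 ⊢
    simp
    field_simp
  | succ d => rw [sum_orthTerm_eq_zero, mul_zero, if_neg (by omega)]

theorem sum_inverseCoeff_mul_qbinom (n : ℕ) (k : ℤ) :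
    ∑ j ∈ range (n + 1), inverseCoeff n j * qbinom (2 * (j : ℤ) + 1) ((j : ℤ) - k) =
      if (n : ℤ) = k ∨ (n : ℤ) = -1 - k then 1 else 0 := by
  rcases le_or_gt 0 k with hk | hk
  · obtain ⟨k, rfl⟩ := Int.eq_ofNat_of_zero_le hk
    rw [sum_inverseCoeff_mul_qbinom_natCast]
    exact if_congr (by omega) rfl rfl
  · obtain ⟨l, rfl⟩ : ∃ l : ℕ, k = -1 - l := ⟨(-1 - k).toNat, by omega⟩
    rw [← if_congr (show n = l ↔ _ by omega) rfl rfl, ← sum_inverseCoeff_mul_qbinom_natCast]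
    refine sum_congr rfl fun j _ => ?_
    rw [← qbinom_symm _ ((j : ℤ) - l)]
    ring_nf

theorem sum_inverseCoeff_mul_qPoch (n : ℕ) (m : ℤ) (h : (n : ℤ) = 2 * m ∨ (n : ℤ) = -1 - 2 * m) :
    ∑ j ∈ range (n + 1), inverseCoeff n j * qPoch (-q) j =
      (-1) ^ m * q ^ (3 * m ^ 2 + 1 * m) := by
  have hj : ∀ j ∈ range (n + 1), inverseCoeff n j * qPoch (-q) j =
      ∑ᶠ m : ℤ, inverseCoeff n j * bilateralTerm 1 (2 * (j : ℤ) + 1) j m := fun j _ => by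
    rw [qPoch_neg_q_eq_finsum, mul_finsum]
  have hm : ∀ m : ℤ, ∑ j ∈ range (n + 1),
      inverseCoeff n j * bilateralTerm 1 (2 * (j : ℤ) + 1) j m =
      (-1) ^ m * q ^ (3 * m ^ 2 + 1 * m) *
        if (n : ℤ) = 2 * m ∨ (n : ℤ) = -1 - 2 * m then 1 else 0 := fun m => by
    rw [← sum_inverseCoeff_mul_qbinom, mul_sum]
    refine sum_congr rfl fun j _ => ?_
    rw [bilateralTerm]
    ring
  rw [sum_congr rfl hj, ← finsum_sum_comm, finsum_congr hm, finsum_eq_single _ m, if_pos h,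
    mul_one]
  · intro m' hm'
    rw [if_neg (by omega), mul_zero]
  · intro j _
    refine (finite_support_mul_qbinom (fun m => (-1) ^ m * q ^ (3 * m ^ 2 + 1 * m))
      (2 * (j : ℤ) + 1) j).subset fun m hm => ?_
    exact right_ne_zero_of_mul hm

theorem sum_eq_sum_inverseCoeff_mul_qPoch (n : ℕ) :
    ∑ r ∈ Finset.range (n + 1),
        (-1 : RatFunc ℚ) ^ r * q ^ (r * (r - 1) / 2) * qPoch (-q) (n - r) *
          qbinom (2 * (n : ℤ) - r + 1) r *
          ((1 - q ^ (2 * n + 1)) / (1 - q ^ (2 * (n : ℤ) - r + 1))) =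
      ∑ j ∈ range (n + 1), inverseCoeff n j * qPoch (-q) j := by
  rw [← sum_flip]
  refine sum_congr rfl fun j hj => ?_
  obtain ⟨r, rfl⟩ := Nat.exists_eq_add_of_le (Nat.le_of_lt_succ (mem_range.mp hj))
  rw [inverseCoeff, show j + r - j = r by omega, show j + r - r = j by omega,
    Nat.choose_two_right,
    show ((j + r : ℕ) : ℤ) + j + 1 = (j + r + j + 1 : ℕ) by push_cast; ring,
    show ((j + r : ℕ) : ℤ) - j = r by push_cast; ring,
    show 2 * ((j + r : ℕ) : ℤ) - r + 1 = (j + r + j + 1 : ℕ) by push_cast; ring,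
    zpow_natCast]
  ring

/-- Theorem 2.1: for `n ≥ 1`,
`∑_{r=0}^n (-1)^r q^(C(r,2)) (-q;q)_(n-r) [2n-r+1, r]_q (1-q^(2n+1))/(1-q^(2n-r+1))`
equals `(-1)^m q^(m(3m-1))` if `n = 2m-1` and `(-1)^m q^(m(3m+1))` if `n = 2m`. -/
theorem truncated_gauss_U_identity (n : ℕ) (hn : 1 ≤ n) (m : ℕ) :
    ((n : ℤ) = 2 * m - 1 →
      ∑ r ∈ Finset.range (n + 1),
        (-1 : RatFunc ℚ) ^ r * q ^ (r * (r - 1) / 2) * qPoch (-q) (n - r) *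
          qbinom (2 * (n : ℤ) - r + 1) r *
          ((1 - q ^ (2 * n + 1)) / (1 - q ^ (2 * (n : ℤ) - r + 1))) =
        (-1) ^ m * q ^ ((m : ℤ) * (3 * m - 1))) ∧
    ((n : ℤ) = 2 * m →
      ∑ r ∈ Finset.range (n + 1),
        (-1 : RatFunc ℚ) ^ r * q ^ (r * (r - 1) / 2) * qPoch (-q) (n - r) *
          qbinom (2 * (n : ℤ) - r + 1) r *
          ((1 - q ^ (2 * n + 1)) / (1 - q ^ (2 * (n : ℤ) - r + 1))) =
        (-1) ^ m * q ^ ((m : ℤ) * (3 * m + 1))) := by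
  rw [sum_eq_sum_inverseCoeff_mul_qPoch]
  refine ⟨fun h => ?_, fun h => ?_⟩
  · rw [sum_inverseCoeff_mul_qPoch n (-m) (by omega), zpow_neg, ← inv_zpow, zpow_natCast]
    norm_num
    ring_nf
  · rw [sum_inverseCoeff_mul_qPoch n m (by omega), zpow_natCast]
    ring_nf
end

section
/- For every integer n ≥ 1, define Ũ_n = ∑_{r=0}^{n} (-1)^r q^{r(r+1)/2} (-q;q)_{n-r} [2n-r+1 choose r]_q. Then the following telescoping identity holds in ℚ(q): ∑_{r=0}^{n} (-1)^r q^{r(r-1)/2} (-q;q)_{n-r} [2n-r+1 choose r]_q · (1-q^{2n+1})/(1-q^{2n-r+1}) = Ũ_n - Ũ_{n-1}. -/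
open Finset

/-- `Ũ_n = ∑_{r=0}^n (-1)^r q^(C(r+1,2)) (-q;q)_(n-r) [2n-r+1, r]_q`. -/
noncomputable def Utilde (n : ℕ) : RatFunc ℚ :=
  ∑ r ∈ Finset.range (n + 1),
    (-1 : RatFunc ℚ) ^ r * q ^ (r * (r + 1) / 2) * qPoch (-q) (n - r) *
      qbinom (2 * (n : ℤ) - r + 1) r

theorem one_sub_q_pow_succ_ne_zero (k : ℕ) : 1 - q ^ (k + 1) ≠ 0 := by
  intro h
  have hX : (algebraMap (Polynomial ℚ) (RatFunc ℚ)) (Polynomial.X ^ (k + 1)) =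
      (algebraMap (Polynomial ℚ) (RatFunc ℚ)) 1 := by
    rw [map_pow, RatFunc.algebraMap_X, map_one]
    exact (sub_eq_zero.mp h).symm
  have hdeg := congrArg Polynomial.natDegree (RatFunc.algebraMap_injective ℚ hX)
  simp at hdeg

theorem qPoch_q_succ (k : ℕ) : qPoch q (k + 1) = qPoch q k * (1 - q ^ (k + 1)) := by
  rw [qPoch, prod_range_succ, ← qPoch, ← pow_succ']

theorem qPoch_q_ne_zero (k : ℕ) : qPoch q k ≠ 0 :=
  prod_ne_zero_iff.mpr fun i _ => by
    rw [← pow_succ']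
    exact one_sub_q_pow_succ_ne_zero i

theorem qbinom_natCast {m k : ℕ} (h : k ≤ m) :
    qbinom m k = qPoch q m / (qPoch q k * qPoch q (m - k)) := by
  have hsub : ((m : ℤ) - k).toNat = m - k := by omega
  simp [qbinom, h, hsub]

/-- The absorption identity `[m+1, k+1] (1 - q^(k+1)) = [m, k] (1 - q^(m+1))`. -/
theorem qbinom_succ_succ_mul {m k : ℕ} (h : k ≤ m) :
    qbinom ((m + 1 : ℕ) : ℤ) ((k + 1 : ℕ) : ℤ) * (1 - q ^ (k + 1)) =
      qbinom m k * (1 - q ^ (m + 1)) := by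
  rw [qbinom_natCast h, qbinom_natCast (Nat.succ_le_succ h), Nat.succ_sub_succ, qPoch_q_succ,
    qPoch_q_succ]
  have hk := one_sub_q_pow_succ_ne_zero k
  have hPk := qPoch_q_ne_zero k
  have hPm := qPoch_q_ne_zero (m - k)
  field_simp

/-- The telescoping identity from the proof of Theorem 2.5. -/
theorem Utilde_telescoping (n : ℕ) (hn : 1 ≤ n) :
    ∑ r ∈ Finset.range (n + 1),
        (-1 : RatFunc ℚ) ^ r * q ^ (r * (r - 1) / 2) * qPoch (-q) (n - r) *
          qbinom (2 * (n : ℤ) - r + 1) r *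
          ((1 - q ^ (2 * n + 1)) / (1 - q ^ (2 * (n : ℤ) - r + 1))) =
      Utilde n - Utilde (n - 1) := by
  obtain ⟨m, rfl⟩ : ∃ m, n = m + 1 := ⟨n - 1, by omega⟩
  rw [Nat.add_sub_cancel, eq_sub_iff_add_eq, ← eq_sub_iff_add_eq', eq_comm, Utilde, Utilde,
    ← sum_sub_distrib, sum_range_succ']
  have hzero : (1 : RatFunc ℚ) - q ^ (2 * (m + 1) + 1) ≠ 0 := one_sub_q_pow_succ_ne_zero _
  have hexp : (2 * ((m + 1 : ℕ) : ℤ) - (0 : ℕ) + 1) = ((2 * (m + 1) + 1 : ℕ) : ℤ) := by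
    push_cast; ring
  rw [hexp, zpow_natCast, div_self hzero]
  simp only [zero_mul, Nat.zero_div, mul_one, sub_self, add_zero]
  refine sum_congr rfl fun s hs => ?_
  have hsm : s ≤ m := Nat.lt_succ_iff.mp (mem_range.mp hs)
  obtain ⟨d, rfl⟩ := Nat.exists_eq_add_of_le hsm
  have htop : (2 * ((s + d + 1 : ℕ) : ℤ) - (s + 1 : ℕ) + 1) = ((s + 2 * d + 1 + 1 : ℕ) : ℤ) := by
    push_cast; ring
  have hbot : (2 * ((s + d : ℕ) : ℤ) - s + 1) = ((s + 2 * d + 1 : ℕ) : ℤ) := by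
    push_cast; ring
  have htri : (s + 1) * (s + 1 + 1) / 2 = s * (s + 1) / 2 + (s + 1) := by
    rw [show (s + 1) * (s + 1 + 1) = s * (s + 1) + (s + 1) * 2 by ring,
      Nat.add_mul_div_right _ _ two_pos]
  have hprev : (s + 1) * (s + 1 - 1) / 2 = s * (s + 1) / 2 := by
    rw [Nat.add_sub_cancel, mul_comm]
  have habs := qbinom_succ_succ_mul (show s ≤ s + 2 * d + 1 by omega)
  have hne := one_sub_q_pow_succ_ne_zero (s + 2 * d + 1)
  rw [htop, hbot, htri, hprev, zpow_natCast, Nat.succ_sub_succ]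
  rw [← div_eq_iff hne] at habs
  rw [← habs, pow_add q _ (s + 1)]
  generalize q ^ (s * (s + 1) / 2) = t
  field_simp
  ring
end
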